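/- Let q be real with 0 < q < 1, α ≥ 1 an integer, d an odd positive integer, χ a Dirichlet character modulo d, x > 0 real, and s ∈ ℂ. Assume that for every l with 0 ≤ l ≤ d−1 the convergence condition q^{α(x+l)} · [d:q^α] < (1 − q^{αd}) · [x+l:q^α] holds. Then L_q^χ(s, x | α) = ( [2:q] / [2:q^d] ) · Σ_{l=0}^{d−1} ( (−1)^l χ(l) / [x+l:q^α]^s ) · Σ_{k=0}^∞ q^{α k (x+l) + l} C(−s,k) Ẽ_{k,q^d}(α) ( [d:q^α] / [x+l:q^α] )^k, where C(−s,k) = ( Π_{i=0}^{k−1} (−s − i) ) / k!. -/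

import Mathlib

open scoped BigOperators

/-- `[x:q] = (q^x - 1)/(q - 1)` with real exponentiation. -/
noncomputable def qNum (q x : ℝ) : ℝ := (q ^ x - 1) / (q - 1)

/-- Weighted `q`-Euler polynomial `Ẽ_{n,q}(x|α) = [2:q] ∑_{m≥0} (-1)^m q^m [m+x:q^α]^n`;
at `x = 0` these are the weighted `q`-Euler numbers. -/
noncomputable def qEuler (q : ℝ) (α n : ℕ) (x : ℝ) : ℝ :=
  qNum q 2 * ∑' m : ℕ, (-1 : ℝ) ^ m * q ^ m * (qNum (q ^ α) ((m : ℝ) + x)) ^ n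

/-- Dirichlet `q`-`L`-function
`L_q^χ(s,x|α) = [2:q] ∑_{m≥0} q^m χ(m) (-1)^m [x+m:q^α]^{-s}`. -/
noncomputable def qLfun (q : ℝ) (d : ℕ) (χ : DirichletCharacter ℂ d) (α : ℕ)
    (s : ℂ) (x : ℝ) : ℂ :=
  (qNum q 2 : ℂ) *
    ∑' m : ℕ, (q : ℂ) ^ m * χ (m : ZMod d) * (-1 : ℂ) ^ m *
      ((qNum (q ^ α) (x + (m : ℝ)) : ℝ) : ℂ) ^ (-s)

/-- Generalized binomial coefficient `C(z,k) = z(z-1)⋯(z-k+1)/k!`. -/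
noncomputable def genBinom (z : ℂ) (k : ℕ) : ℂ :=
  (∏ i ∈ Finset.range k, (z - (i : ℂ))) / (k.factorial : ℂ)

theorem genBinom_eq_choose (z : ℂ) (k : ℕ) : genBinom z k = Ring.choose z k := by
  have hsmeval : (descPochhammer ℤ k).smeval z = ∏ i ∈ Finset.range k, (z - (i : ℂ)) := by
    induction k with
    | zero => simp
    | succ k ih =>
      rw [Finset.prod_range_succ, ← ih]
      simp [descPochhammer_succ_right, Polynomial.smeval_mul, Polynomial.smeval_natCast]
  rw [genBinom, ← hsmeval, Ring.descPochhammer_eq_factorial_smul_choose, nsmul_eq_mul,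
    mul_div_cancel_left₀ _ (Nat.cast_ne_zero.mpr k.factorial_ne_zero)]

theorem hasSum_genBinom (a : ℂ) {z : ℂ} (hz : ‖z‖ < 1) :
    HasSum (fun k : ℕ => genBinom a k * z ^ k) ((1 + z) ^ a) := by
  have hmem : z ∈ Metric.eball (0 : ℂ) 1 := by
    rw [← ENNReal.ofReal_one, Metric.eball_ofReal]
    simpa using hz
  simpa [genBinom_eq_choose, binomialSeries, FormalMultilinearSeries.coeff_ofScalars, mul_comm] using
    (Complex.one_add_cpow_hasFPowerSeriesOnBall_zero (a := a)).hasSum hmem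

theorem summable_norm_genBinom (a : ℂ) {r : ℝ} (hr0 : 0 ≤ r) (hr1 : r < 1) :
    Summable (fun k : ℕ => ‖genBinom a k‖ * r ^ k) := by
  have hz : ‖(r : ℂ)‖ < 1 := by simpa [abs_of_nonneg hr0] using hr1
  simpa [abs_of_nonneg hr0] using (hasSum_genBinom a hz).summable.norm

/-- Expanding `(1 + u j) ^ a` and interchanging the two summations. -/
theorem tsum_mul_one_add_cpow (a : ℂ) {w u : ℕ → ℂ} {r : ℝ} (hw : Summable (fun j => ‖w j‖))
    (hr1 : r < 1) (hu : ∀ j, ‖u j‖ ≤ r) :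
    ∑' j, w j * (1 + u j) ^ a = ∑' k, genBinom a k * ∑' j, w j * u j ^ k := by
  have hr0 : 0 ≤ r := (norm_nonneg _).trans (hu 0)
  have hsum : Summable (Function.uncurry fun j k : ℕ => w j * (genBinom a k * u j ^ k)) := by
    refine Summable.of_norm_bounded (hw.mul_of_nonneg (summable_norm_genBinom a hr0 hr1)
      (fun _ => norm_nonneg _) (fun _ => by positivity)) ?_
    rintro ⟨j, k⟩
    simp only [Function.uncurry, norm_mul, norm_pow]
    gcongr
    exact hu j
  calc ∑' j, w j * (1 + u j) ^ a = ∑' j, ∑' k, w j * (genBinom a k * u j ^ k) := by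
        refine tsum_congr fun j => ?_
        rw [tsum_mul_left, (hasSum_genBinom a ((hu j).trans_lt hr1)).tsum_eq]
    _ = ∑' k, ∑' j, w j * (genBinom a k * u j ^ k) := hsum.tsum_comm.symm
    _ = _ := by
        refine tsum_congr fun k => ?_
        rw [← tsum_mul_left]
        exact tsum_congr fun j => by ring

theorem qNum_pos {q x : ℝ} (hq0 : 0 < q) (hq1 : q < 1) (hx : 0 < x) : 0 < qNum q x :=
  div_pos_of_neg_of_neg (by linarith [Real.rpow_lt_one hq0.le hq1 hx]) (by linarith)

theorem qNum_nonneg {q x : ℝ} (hq0 : 0 < q) (hq1 : q < 1) (hx : 0 ≤ x) : 0 ≤ qNum q x :=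
  div_nonneg_of_nonpos (by linarith [Real.rpow_le_one hq0.le hq1.le hx]) (by linarith)

theorem one_sub_mul_qNum_le_one {q : ℝ} (hq0 : 0 < q) (hq1 : q < 1) (x : ℝ) :
    (1 - q) * qNum q x ≤ 1 := by
  have hq : q - 1 ≠ 0 := by linarith
  have h : (1 - q) * qNum q x = 1 - q ^ x := by
    unfold qNum
    field_simp
    ring
  linarith [Real.rpow_pos_of_pos hq0 x]

theorem qNum_add_natCast_mul {q : ℝ} (hq0 : 0 < q) (hq1 : q < 1) {d : ℕ} (hd : 0 < d)
    (y : ℝ) (j : ℕ) :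
    qNum q (y + d * j) = qNum q y + q ^ y * qNum q d * qNum (q ^ d) j := by
  have hq : q - 1 ≠ 0 := by linarith
  have hqd : q ^ d - 1 ≠ 0 := by linarith [pow_lt_one₀ hq0.le hq1 hd.ne']
  simp only [qNum, Real.rpow_add hq0, Real.rpow_mul hq0.le, Real.rpow_natCast]
  field_simp
  ring

theorem tendsto_qNum_add_natCast {q : ℝ} (hq0 : 0 < q) (hq1 : q < 1) (x : ℝ) :
    Filter.Tendsto (fun m : ℕ => qNum q (x + m)) Filter.atTop (nhds (1 / (1 - q))) := by
  have h := (((tendsto_pow_atTop_nhds_zero_of_lt_one hq0.le hq1).const_mul (q ^ x)).sub_const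
    1).div_const (q - 1)
  have hlim : (q ^ x * 0 - 1) / (q - 1) = 1 / (1 - q) := by
    rw [mul_zero, zero_sub, ← neg_sub 1 q, neg_div_neg_eq]
  rw [hlim] at h
  simpa only [qNum, Real.rpow_add hq0, Real.rpow_natCast] using h

theorem summable_qLfun {q : ℝ} (hq0 : 0 < q) (hq1 : q < 1) {α : ℕ} (hα : α ≠ 0) {d : ℕ}
    (χ : DirichletCharacter ℂ d) (s : ℂ) (x : ℝ) :
    Summable fun m : ℕ => (q : ℂ) ^ m * χ (m : ZMod d) * (-1 : ℂ) ^ m *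
      ((qNum (q ^ α) (x + (m : ℝ)) : ℝ) : ℂ) ^ (-s) := by
  have hQ1 : q ^ α < 1 := pow_lt_one₀ hq0.le hq1 hα
  have hslit : ((1 / (1 - q ^ α) : ℝ) : ℂ) ∈ Complex.slitPlane :=
    Complex.ofReal_mem_slitPlane.mpr (by rw [one_div, inv_pos]; linarith)
  have htend := ((continuousAt_cpow_const (b := -s) hslit).tendsto.comp
    ((Complex.continuous_ofReal.tendsto _).comp
      (tendsto_qNum_add_natCast (pow_pos hq0 α) hQ1 x))).norm
  obtain ⟨C, hC⟩ := htend.bddAbove_range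
  refine Summable.of_norm_bounded ((summable_geometric_of_lt_one hq0.le hq1).mul_right C) ?_
  intro m
  have hm : ‖((qNum (q ^ α) (x + (m : ℝ)) : ℝ) : ℂ) ^ (-s)‖ ≤ C := hC ⟨m, rfl⟩
  simp only [norm_mul, norm_pow, norm_neg, norm_one, one_pow, mul_one, Complex.norm_real,
    Real.norm_of_nonneg hq0.le]
  calc q ^ m * ‖χ (m : ZMod d)‖ * _ ≤ q ^ m * 1 * C := by
        gcongr
        exact χ.norm_le_one _
    _ = q ^ m * C := by ring

theorem sum_zmod_eq_sum_range {M : Type*} [AddCommMonoid M] (d : ℕ) [NeZero d] (f : ℕ → M) :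
    ∑ j : ZMod d, f j.val = ∑ l ∈ Finset.range d, f l := by
  cases d with
  | zero => exact absurd rfl (NeZero.ne 0)
  | succ n => exact Fin.sum_univ_eq_sum_range f (n + 1)

/-- The part of the `q`-`L`-series over `m ≡ l (mod d)`, expanded by the binomial series. -/
theorem tsum_residue_class {q : ℝ} (hq0 : 0 < q) (hq1 : q < 1) {α : ℕ} (hα : α ≠ 0)
    {d : ℕ} (hd0 : 0 < d) (hdo : Odd d) (χ : DirichletCharacter ℂ d) {x : ℝ} (hx : 0 < x)
    (s : ℂ) (l : ℕ)
    (hconv : q ^ ((α : ℝ) * (x + l)) * qNum (q ^ α) d <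
        (1 - q ^ (α * d)) * qNum (q ^ α) (x + l)) :
    (qNum (q ^ d) 2 : ℂ) * ∑' j : ℕ, (q : ℂ) ^ (l + d * j) * χ ((l + d * j : ℕ) : ZMod d) *
        (-1 : ℂ) ^ (l + d * j) * ((qNum (q ^ α) (x + ((l + d * j : ℕ) : ℝ)) : ℝ) : ℂ) ^ (-s) =
      ((-1 : ℂ) ^ l * χ (l : ZMod d) / ((qNum (q ^ α) (x + l) : ℝ) : ℂ) ^ s) *
        ∑' k : ℕ, ((q ^ ((↑(α * k) : ℝ) * (x + l) + l) : ℝ) : ℂ) * genBinom (-s) k *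
          ((qEuler (q ^ d) α k 0 : ℝ) : ℂ) *
            ((qNum (q ^ α) d / qNum (q ^ α) (x + l) : ℝ) : ℂ) ^ k := by
  have hQ0 : 0 < q ^ α := pow_pos hq0 α
  have hQ1 : q ^ α < 1 := pow_lt_one₀ hq0.le hq1 hα
  have hQd1 : (q ^ α) ^ d < 1 := pow_lt_one₀ hQ0.le hQ1 hd0.ne'
  have hy : 0 < x + l := by positivity
  have hpow : (q ^ d) ^ α = (q ^ α) ^ d := by rw [← pow_mul, ← pow_mul, mul_comm]
  have hrpow : q ^ ((α : ℝ) * (x + l)) = (q ^ α) ^ (x + l) := by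
    rw [Real.rpow_mul hq0.le, Real.rpow_natCast]
  rw [hrpow, pow_mul] at hconv
  set A := qNum (q ^ α) (x + l) with hAdef
  have hA : 0 < A := qNum_pos hQ0 hQ1 hy
  set c := (q ^ α) ^ (x + l) * (qNum (q ^ α) d / A) with hcdef
  have hc0 : 0 ≤ c := mul_nonneg (Real.rpow_nonneg hQ0.le _)
    (div_nonneg (qNum_nonneg hQ0 hQ1 d.cast_nonneg) hA.le)
  have hc1 : c < 1 - (q ^ α) ^ d := by
    rw [hcdef, ← mul_div_assoc, div_lt_iff₀ hA]
    exact hconv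
  set v : ℕ → ℝ := fun j => qNum ((q ^ α) ^ d) j with hvdef
  have hv0 (j : ℕ) : 0 ≤ v j := qNum_nonneg (pow_pos hQ0 d) hQd1 j.cast_nonneg
  have hv1 (j : ℕ) : (1 - (q ^ α) ^ d) * v j ≤ 1 := one_sub_mul_qNum_le_one (pow_pos hQ0 d) hQd1 _
  have hu (j : ℕ) : ‖((c * v j : ℝ) : ℂ)‖ ≤ c / (1 - (q ^ α) ^ d) := by
    rw [Complex.norm_real, Real.norm_of_nonneg (mul_nonneg hc0 (hv0 j)), div_eq_mul_inv]
    gcongr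
    rw [← one_div, le_div_iff₀ (by linarith), mul_comm]
    exact hv1 j
  set w : ℕ → ℂ := fun j => (-1) ^ j * ((q : ℂ) ^ d) ^ j with hwdef
  have hw : Summable fun j => ‖w j‖ := by
    simpa [hwdef, abs_of_pos hq0] using
      summable_geometric_of_lt_one (pow_nonneg hq0.le d) (pow_lt_one₀ hq0.le hq1 hd0.ne')
  have hterm (j : ℕ) : (q : ℂ) ^ (l + d * j) * χ ((l + d * j : ℕ) : ZMod d) *
        (-1 : ℂ) ^ (l + d * j) * ((qNum (q ^ α) (x + ((l + d * j : ℕ) : ℝ)) : ℝ) : ℂ) ^ (-s) =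
      ((-1 : ℂ) ^ l * χ (l : ZMod d) / (A : ℂ) ^ s * (q : ℂ) ^ l) *
        (w j * (1 + ((c * v j : ℝ) : ℂ)) ^ (-s)) := by
    have hbase : qNum (q ^ α) (x + ((l + d * j : ℕ) : ℝ)) = A * (1 + c * v j) := by
      push_cast
      rw [← add_assoc, qNum_add_natCast_mul hQ0 hQ1 hd0, ← hAdef, hcdef]
      field_simp
      rfl
    have hcpow : ((A * (1 + c * v j) : ℝ) : ℂ) ^ (-s) =
        ((A : ℂ) ^ s)⁻¹ * (1 + ((c * v j : ℝ) : ℂ)) ^ (-s) := by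
      rw [Complex.ofReal_mul, Complex.mul_cpow_ofReal_nonneg hA.le
        (by linarith [mul_nonneg hc0 (hv0 j)]), Complex.cpow_neg (A : ℂ)]
      push_cast
      rfl
    rw [hbase, hcpow]
    simp only [hwdef, Nat.cast_add, Nat.cast_mul, ZMod.natCast_self, zero_mul, add_zero, pow_add,
      pow_mul, hdo.neg_one_pow]
    ring
  have heuler (k : ℕ) : ((qEuler (q ^ d) α k 0 : ℝ) : ℂ) =
      (qNum (q ^ d) 2 : ℂ) * ∑' j, w j * (v j : ℂ) ^ k := by
    simp only [qEuler, hpow, add_zero, hwdef, hvdef]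
    push_cast
    rfl
  simp only [hterm]
  rw [tsum_mul_left, tsum_mul_one_add_cpow (-s) hw ((div_lt_one (by linarith)).mpr hc1) hu,
    mul_left_comm, mul_assoc, ← tsum_mul_left, ← tsum_mul_left]
  congr 1
  refine tsum_congr fun k => ?_
  have hexp : q ^ ((↑(α * k) : ℝ) * (x + l) + l) = q ^ l * ((q ^ α) ^ (x + l)) ^ k := by
    rw [Real.rpow_add hq0, Real.rpow_natCast, mul_comm, Nat.cast_mul, mul_right_comm,
      Real.rpow_mul hq0.le, hrpow, Real.rpow_natCast]
  have hinner : ∑' j, w j * ((c * v j : ℝ) : ℂ) ^ k =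
      (c : ℂ) ^ k * ∑' j, w j * (v j : ℂ) ^ k := by
    rw [← tsum_mul_left]
    refine tsum_congr fun j => ?_
    push_cast
    ring
  rw [hinner, heuler, hexp, hcdef]
  push_cast
  ring

theorem statement15 (q : ℝ) (hq0 : 0 < q) (hq1 : q < 1) (α : ℕ) (hα : 1 ≤ α)
    (d : ℕ) (hd0 : 0 < d) (hdo : Odd d) (χ : DirichletCharacter ℂ d)
    (x : ℝ) (hx : 0 < x) (s : ℂ)
    (hconv : ∀ l : ℕ, l ≤ d - 1 →
      q ^ ((α : ℝ) * (x + l)) * qNum (q ^ α) d <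
        (1 - q ^ (α * d)) * qNum (q ^ α) (x + l)) :
    qLfun q d χ α s x =
      ((qNum q 2 / qNum (q ^ d) 2 : ℝ) : ℂ) *
        ∑ l ∈ Finset.range d,
          ((-1 : ℂ) ^ l * χ (l : ZMod d) / ((qNum (q ^ α) (x + l) : ℝ) : ℂ) ^ s) *
            ∑' k : ℕ,
              ((q ^ ((↑(α * k) : ℝ) * (x + l) + l) : ℝ) : ℂ) * genBinom (-s) k *
                ((qEuler (q ^ d) α k 0 : ℝ) : ℂ) *
                  ((qNum (q ^ α) d / qNum (q ^ α) (x + l) : ℝ) : ℂ) ^ k := by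
  have : NeZero d := ⟨hd0.ne'⟩
  have hα0 : α ≠ 0 := Nat.one_le_iff_ne_zero.mp hα
  have hE : (qNum (q ^ d) 2 : ℂ) ≠ 0 := Complex.ofReal_ne_zero.mpr
    (qNum_pos (pow_pos hq0 d) (pow_lt_one₀ hq0.le hq1 hd0.ne') two_pos).ne'
  rw [qLfun, Nat.sumByResidueClasses (summable_qLfun hq0 hq1 hα0 χ s x) d,
    sum_zmod_eq_sum_range d fun l => ∑' j : ℕ, (q : ℂ) ^ (l + d * j) *
      χ ((l + d * j : ℕ) : ZMod d) * (-1 : ℂ) ^ (l + d * j) *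
        ((qNum (q ^ α) (x + ((l + d * j : ℕ) : ℝ)) : ℝ) : ℂ) ^ (-s),
    Complex.ofReal_div, div_mul_eq_mul_div, mul_div_assoc, eq_comm]
  congr 1
  rw [div_eq_iff hE, mul_comm, Finset.mul_sum]
  refine Finset.sum_congr rfl fun l hl => ?_
  exact (tsum_residue_class hq0 hq1 hα0 hd0 hdo χ hx s l
    (hconv l (Nat.le_sub_one_of_lt (Finset.mem_range.mp hl)))).symm
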